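/- arXiv:2512.21971 — 2 statements merged into one kernel-verified Lean document; each statement's English description precedes it below -/
import Mathlib

section
/- Let A be a cocommutative Hopf algebra over k and let the commutative k-algebra R be a module algebra over A via ⇀. On the vector space R ⊗ A define the smash product (f ⊗ a)·(g ⊗ b) = f(a₁ ⇀ g) ⊗ a₂b, and the maps ι(f) = f ⊗ 1, Δ_H(f ⊗ a) = (f ⊗ a₁) ⊗_R (1 ⊗ a₂), ε_H(f ⊗ a) = f·ε(a), and S_H(f ⊗ a) = (S(a₁) ⇀ f) ⊗ S(a₂). Then R#A = (R ⊗ A, ·, Δ_H, ε_H, S_H, ι) is a Hopf algebroid over R in Lu's sense; in particular S_H is an algebra anti-isomorphism of the smash product with S_H ∘ ι = ι, and for all f ∈ R, a ∈ A one has S_H(f ⊗ a₁)·(1 ⊗ a₂) = ι(ε_H(S_H(f ⊗ a))) and (f ⊗ a₁)·S_H(1 ⊗ a₂) = ι(f·ε(a)). -/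
open scoped TensorProduct

set_option maxSynthPendingDepth 3

section Sweedler

structure Lin2 (k : Type*) {A M : Type*} [Field k] [Ring A] [Algebra k A] [AddCommGroup M]
    [Module k M] (φ : A → A → M) : Prop where
  a1 : ∀ x x' y, φ (x + x') y = φ x y + φ x' y
  s1 : ∀ (c : k) x y, φ (c • x) y = c • φ x y
  a2 : ∀ x y y', φ x (y + y') = φ x y + φ x y'
  s2 : ∀ (c : k) x y, φ x (c • y) = c • φ x y

structure Lin3 (k : Type*) {A M : Type*} [Field k] [Ring A] [Algebra k A] [AddCommGroup M]
    [Module k M] (φ : A → A → A → M) : Prop where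
  a1 : ∀ x x' y z, φ (x + x') y z = φ x y z + φ x' y z
  s1 : ∀ (c : k) x y z, φ (c • x) y z = c • φ x y z
  a2 : ∀ x y y' z, φ x (y + y') z = φ x y z + φ x y' z
  s2 : ∀ (c : k) x y z, φ x (c • y) z = c • φ x y z
  a3 : ∀ x y z z', φ x y (z + z') = φ x y z + φ x y z'
  s3 : ∀ (c : k) x y z, φ x y (c • z) = c • φ x y z

variable {k A M : Type*} [Field k] [Ring A] [HopfAlgebra k A] [AddCommGroup M] [Module k M]
  {na : A → ℕ} {a1 a2 : A → ℕ → A}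

open Coalgebra HopfAlgebra

/-- sums along a Sweedler representation are values of a linear map on `A ⊗ A` -/
theorem sw_lift
    (hrepr : ∀ a : A, comul (R := k) a = ∑ i ∈ Finset.range (na a), a1 a i ⊗ₜ[k] a2 a i)
    {φ : A → A → M} (h : Lin2 k φ) :
    ∃ Φ : A ⊗[k] A →ₗ[k] M, (∀ x y, Φ (x ⊗ₜ y) = φ x y) ∧
      ∀ a, ∑ i ∈ Finset.range (na a), φ (a1 a i) (a2 a i) = Φ (comul (R := k) a) := by
  refine ⟨TensorProduct.lift (LinearMap.mk₂ k φ h.a1 h.s1 h.a2 h.s2), fun x y => by simp, ?_⟩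
  intro a
  rw [hrepr]
  simp

theorem lift3 {φ : A → A → A → M} (h : Lin3 k φ) :
    ∃ Φ : A →ₗ[k] A →ₗ[k] A →ₗ[k] M, ∀ x y z, Φ x y z = φ x y z := by
  refine ⟨LinearMap.mk₂ k (fun x y => ⟨⟨fun z => φ x y z, h.a3 x y⟩, fun c z => h.s3 c x y z⟩)
    ?_ ?_ ?_ ?_, fun x y z => rfl⟩
  · intros; ext; exact h.a1 ..
  · intros; ext; exact h.s1 ..
  · intros; ext; exact h.a2 ..
  · intros; ext; exact h.s2 ..

theorem sw_comm
    (hrepr : ∀ a : A, comul (R := k) a = ∑ i ∈ Finset.range (na a), a1 a i ⊗ₜ[k] a2 a i)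
    (hcc : ∀ a : A, (TensorProduct.comm k A A) (comul (R := k) a) = comul (R := k) a)
    (a : A) (φ : A → A → M)
    (h : Lin2 k φ := by
      constructor <;> intros <;>
      simp [TensorProduct.tmul_add, TensorProduct.add_tmul, ← TensorProduct.smul_tmul', mul_add,
        add_mul, Finset.sum_add_distrib, Finset.smul_sum]) :
    ∑ i ∈ Finset.range (na a), φ (a1 a i) (a2 a i)
      = ∑ i ∈ Finset.range (na a), φ (a2 a i) (a1 a i) := by
  obtain ⟨Φ, h1, h2⟩ := sw_lift hrepr h
  rw [h2, ← hcc, hrepr]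
  simp [h1]

theorem sw_mul
    (hrepr : ∀ a : A, comul (R := k) a = ∑ i ∈ Finset.range (na a), a1 a i ⊗ₜ[k] a2 a i)
    (a b : A) (φ : A → A → M)
    (h : Lin2 k φ := by
      constructor <;> intros <;>
      simp [TensorProduct.tmul_add, TensorProduct.add_tmul, ← TensorProduct.smul_tmul', mul_add,
        add_mul, Finset.sum_add_distrib, Finset.smul_sum]) :
    ∑ i ∈ Finset.range (na (a * b)), φ (a1 (a * b) i) (a2 (a * b) i)
      = ∑ i ∈ Finset.range (na a), ∑ j ∈ Finset.range (na b),
        φ (a1 a i * a1 b j) (a2 a i * a2 b j) := by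
  obtain ⟨Φ, h1, h2⟩ := sw_lift hrepr h
  rw [h2, Bialgebra.comul_mul, hrepr a, hrepr b, Finset.sum_mul_sum]
  simp [h1]

theorem sw_one
    (hrepr : ∀ a : A, comul (R := k) a = ∑ i ∈ Finset.range (na a), a1 a i ⊗ₜ[k] a2 a i)
    (φ : A → A → M)
    (h : Lin2 k φ := by
      constructor <;> intros <;>
      simp [TensorProduct.tmul_add, TensorProduct.add_tmul, ← TensorProduct.smul_tmul', mul_add,
        add_mul, Finset.sum_add_distrib, Finset.smul_sum]) :
    ∑ i ∈ Finset.range (na (1 : A)), φ (a1 1 i) (a2 1 i) = φ 1 1 := by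
  obtain ⟨Φ, h1, h2⟩ := sw_lift hrepr h
  rw [h2, Bialgebra.comul_one, Algebra.TensorProduct.one_def, h1]

theorem sw_coassoc
    (hrepr : ∀ a : A, comul (R := k) a = ∑ i ∈ Finset.range (na a), a1 a i ⊗ₜ[k] a2 a i)
    (a : A) (φ : A → A → A → M)
    (h : Lin3 k φ := by
      constructor <;> intros <;>
      simp [TensorProduct.tmul_add, TensorProduct.add_tmul, ← TensorProduct.smul_tmul', mul_add,
        add_mul, Finset.sum_add_distrib, Finset.smul_sum]) :
    ∑ i ∈ Finset.range (na a), ∑ j ∈ Finset.range (na (a1 a i)),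
        φ (a1 (a1 a i) j) (a2 (a1 a i) j) (a2 a i)
      = ∑ i ∈ Finset.range (na a), ∑ j ∈ Finset.range (na (a2 a i)),
        φ (a1 a i) (a1 (a2 a i) j) (a2 (a2 a i) j) := by
  obtain ⟨Φ, hΦ⟩ := lift3 h
  have key := congrArg (TensorProduct.lift
    (TensorProduct.uncurry (.id k) A A M ∘ₗ Φ)) (coassoc_apply (R := k) a)
  rw [hrepr a] at key
  simp only [map_sum, LinearMap.rTensor_tmul, LinearMap.lTensor_tmul] at key
  simp only [hrepr (a1 a _), hrepr (a2 a _), TensorProduct.sum_tmul, TensorProduct.tmul_sum,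
    map_sum, TensorProduct.assoc_tmul, TensorProduct.lift.tmul] at key
  simpa [hΦ] using key

theorem sw_counit_left
    (hrepr : ∀ a : A, comul (R := k) a = ∑ i ∈ Finset.range (na a), a1 a i ⊗ₜ[k] a2 a i)
    (a : A) : ∑ i ∈ Finset.range (na a), counit (R := k) (a1 a i) • a2 a i = a :=
  sum_counit_smul (R := k) (a := a) ⟨Finset.range (na a), a1 a, a2 a, (hrepr a).symm⟩

theorem sw_counit_right
    (hrepr : ∀ a : A, comul (R := k) a = ∑ i ∈ Finset.range (na a), a1 a i ⊗ₜ[k] a2 a i)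
    (a : A) : ∑ i ∈ Finset.range (na a), counit (R := k) (a2 a i) • a1 a i = a := by
  have := congrArg (TensorProduct.rid k A) (sum_tmul_counit_eq (R := k) (a := a)
    ⟨Finset.range (na a), a1 a, a2 a, (hrepr a).symm⟩)
  simpa using this

theorem sw_antipode_left
    (hrepr : ∀ a : A, comul (R := k) a = ∑ i ∈ Finset.range (na a), a1 a i ⊗ₜ[k] a2 a i)
    (a : A) : ∑ i ∈ Finset.range (na a), antipode k (a1 a i) * a2 a i
      = counit (R := k) a • (1 : A) :=
  sum_antipode_mul_eq_smul (R := k) (a := a) ⟨Finset.range (na a), a1 a, a2 a, (hrepr a).symm⟩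

theorem sw_antipode_right
    (hrepr : ∀ a : A, comul (R := k) a = ∑ i ∈ Finset.range (na a), a1 a i ⊗ₜ[k] a2 a i)
    (a : A) : ∑ i ∈ Finset.range (na a), a1 a i * antipode k (a2 a i)
      = counit (R := k) a • (1 : A) :=
  sum_mul_antipode_eq_smul (R := k) (a := a) ⟨Finset.range (na a), a1 a, a2 a, (hrepr a).symm⟩

theorem sw_antipode_sq
    (hrepr : ∀ a : A, comul (R := k) a = ∑ i ∈ Finset.range (na a), a1 a i ⊗ₜ[k] a2 a i)
    (hcc : ∀ a : A, (TensorProduct.comm k A A) (comul (R := k) a) = comul (R := k) a)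
    (a : A) : antipode k (antipode k a) = a := by
  have h := sw_coassoc hrepr a
    (fun x y z => antipode k (antipode k x) * antipode k y * z)
  have e1 : ∀ b : A, ∑ j ∈ Finset.range (na b),
      antipode k (antipode k (a1 b j)) * antipode k (a2 b j) = counit (R := k) b • (1 : A) := by
    intro b
    rw [sw_comm hrepr hcc b (fun x y => antipode k (antipode k x) * antipode k y)]
    simp only [← antipode_mul_antidistrib]
    rw [← map_sum, sw_antipode_right hrepr]
    simp
  simp only [← Finset.sum_mul, e1] at h
  simp only [mul_assoc, ← Finset.mul_sum, sw_antipode_left hrepr] at h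
  simp only [smul_mul_assoc, one_mul, mul_smul_comm, mul_one, sw_counit_left hrepr,
    ← map_smul, ← map_sum, sw_counit_right hrepr] at h
  exact h.symm

end Sweedler

/-!
STATEMENT 1: let `A` be a cocommutative Hopf algebra over `k` and let the commutative
`k`-algebra `R` be a module algebra over `A` via `⇀`.  On `R ⊗ A` define the smash
product `(f ⊗ a)·(g ⊗ b) = f(a₁ ⇀ g) ⊗ a₂b` together with `ι(f) = f ⊗ 1`,
`Δ_H(f ⊗ a) = (f ⊗ a₁) ⊗_R (1 ⊗ a₂)`, `ε_H(f ⊗ a) = f·ε(a)` and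
`S_H(f ⊗ a) = (S(a₁) ⇀ f) ⊗ S(a₂)`.  Then `R#A` is a Hopf algebroid over `R` in Lu's
sense; in particular `S_H` is an algebra anti-isomorphism with `S_H ∘ ι = ι`,
`S_H(f ⊗ a₁)·(1 ⊗ a₂) = ι(ε_H(S_H(f ⊗ a)))` and `(f ⊗ a₁)·S_H(1 ⊗ a₂) = ι(f·ε(a))`.

The Hopf algebra `A` is handled with a chosen Sweedler representation
`Δ(a) = ∑ a1 a i ⊗ a2 a i`; the smash product, coproduct, counit and antipode of
`H = R ⊗ A` are given as maps determined on pure tensors by the above formulas.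
-/

theorem stmt1 {k R A : Type*} [Field k] [CharZero k] [CommRing R] [Algebra k R]
    [Ring A] [HopfAlgebra k A]
    -- a chosen Sweedler representation of the coproduct of `A`
    (na : A → ℕ) (a1 a2 : A → ℕ → A)
    (hrepr : ∀ a : A, Coalgebra.comul (R := k) a
        = ∑ i ∈ Finset.range (na a), a1 a i ⊗ₜ[k] a2 a i)
    -- `A` is cocommutative
    (hcc : ∀ a : A, (TensorProduct.comm k A A) (Coalgebra.comul (R := k) a)
        = Coalgebra.comul (R := k) a)
    -- `R` is a module algebra over `A` via `⇀`
    (act : A → R → R)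
    (act_add_left : ∀ (a b : A) (f : R), act (a + b) f = act a f + act b f)
    (act_add_right : ∀ (a : A) (f g : R), act a (f + g) = act a f + act a g)
    (act_smul : ∀ (c : k) (a : A) (f : R), act (c • a) f = c • act a f)
    (act_mul : ∀ (a b : A) (f : R), act (a * b) f = act a (act b f))
    (act_one : ∀ f : R, act 1 f = f)
    (act_mul_right : ∀ (a : A) (f g : R),
      act a (f * g) = ∑ i ∈ Finset.range (na a), act (a1 a i) f * act (a2 a i) g)
    (act_one_right : ∀ a : A, act a 1 = algebraMap k R (Coalgebra.counit (R := k) a))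
    -- the smash product on `H = R ⊗ A`
    (mulH : (R ⊗[k] A) →ₗ[k] (R ⊗[k] A) →ₗ[k] (R ⊗[k] A))
    (hmul : ∀ (f g : R) (a b : A), mulH (f ⊗ₜ[k] a) (g ⊗ₜ[k] b)
        = ∑ i ∈ Finset.range (na a), (f * act (a1 a i) g) ⊗ₜ[k] (a2 a i * b))
    -- the coproduct `Δ_H : H → H ⊗_R H`
    (ΔH : (R ⊗[k] A) →ₗ[R] (R ⊗[k] A) ⊗[R] (R ⊗[k] A))
    (hΔ : ∀ (f : R) (a : A), ΔH (f ⊗ₜ[k] a)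
        = ∑ i ∈ Finset.range (na a), (f ⊗ₜ[k] a1 a i) ⊗ₜ[R] ((1 : R) ⊗ₜ[k] a2 a i))
    -- the counit `ε_H : H → R`
    (εH : (R ⊗[k] A) →ₗ[R] R)
    (hε : ∀ (f : R) (a : A), εH (f ⊗ₜ[k] a) = Coalgebra.counit (R := k) a • f)
    -- the antipode `S_H`
    (SH : R ⊗[k] A → R ⊗[k] A)
    (hSH_add : ∀ x y : R ⊗[k] A, SH (x + y) = SH x + SH y)
    (hSH_smul : ∀ (c : k) (x : R ⊗[k] A), SH (c • x) = c • SH x)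
    (hS : ∀ (f : R) (a : A), SH (f ⊗ₜ[k] a)
        = ∑ i ∈ Finset.range (na a),
            act (HopfAlgebra.antipode (R := k) (a1 a i)) f
              ⊗ₜ[k] HopfAlgebra.antipode (R := k) (a2 a i)) :
    -- the smash product is associative and unital
    (∀ x y z : R ⊗[k] A, mulH (mulH x y) z = mulH x (mulH y z))
    ∧ (∀ x : R ⊗[k] A, mulH ((1 : R) ⊗ₜ[k] (1 : A)) x = x)
    ∧ (∀ x : R ⊗[k] A, mulH x ((1 : R) ⊗ₜ[k] (1 : A)) = x)
    -- `ι : R → H`, `f ↦ f ⊗ 1`, is an algebra homomorphism whose induced left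
    -- `R`-module structure is the canonical one
    ∧ (∀ f g : R, mulH (f ⊗ₜ[k] (1 : A)) (g ⊗ₜ[k] (1 : A)) = (f * g) ⊗ₜ[k] (1 : A))
    ∧ (∀ (f : R) (x : R ⊗[k] A), mulH (f ⊗ₜ[k] (1 : A)) x = f • x)
    -- coassociativity of `Δ_H`
    ∧ (∀ x : R ⊗[k] A,
        (TensorProduct.assoc R (R ⊗[k] A) (R ⊗[k] A) (R ⊗[k] A))
            ((TensorProduct.map ΔH LinearMap.id) (ΔH x))
          = (TensorProduct.map LinearMap.id ΔH) (ΔH x))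
    -- `Δ_H(x)(ι(g) ⊗ 1 − 1 ⊗ ι(g)) = 0`
    ∧ (∀ (f g : R) (a : A),
        ∑ i ∈ Finset.range (na a),
            mulH (f ⊗ₜ[k] a1 a i) (g ⊗ₜ[k] (1 : A)) ⊗ₜ[R] ((1 : R) ⊗ₜ[k] a2 a i)
          = ∑ i ∈ Finset.range (na a),
              (f ⊗ₜ[k] a1 a i) ⊗ₜ[R] mulH ((1 : R) ⊗ₜ[k] a2 a i) (g ⊗ₜ[k] (1 : A)))
    -- `Δ_H` is an algebra homomorphism onto its image
    ∧ (∀ (f g : R) (a b : A),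
        ΔH (mulH (f ⊗ₜ[k] a) (g ⊗ₜ[k] b))
          = ∑ i ∈ Finset.range (na a), ∑ j ∈ Finset.range (na b),
              mulH (f ⊗ₜ[k] a1 a i) (g ⊗ₜ[k] a1 b j)
                ⊗ₜ[R] mulH ((1 : R) ⊗ₜ[k] a2 a i) ((1 : R) ⊗ₜ[k] a2 b j))
    ∧ ΔH ((1 : R) ⊗ₜ[k] (1 : A))
        = ((1 : R) ⊗ₜ[k] (1 : A)) ⊗ₜ[R] ((1 : R) ⊗ₜ[k] (1 : A))
    -- counit axioms
    ∧ εH ((1 : R) ⊗ₜ[k] (1 : A)) = 1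
    ∧ (∀ x y : R ⊗[k] A, εH (mulH x (y - εH y ⊗ₜ[k] (1 : A))) = 0)
    ∧ (∀ (f : R) (a : A),
        ∑ i ∈ Finset.range (na a), εH (f ⊗ₜ[k] a1 a i) • ((1 : R) ⊗ₜ[k] a2 a i)
          = f ⊗ₜ[k] a)
    ∧ (∀ (f : R) (a : A),
        ∑ i ∈ Finset.range (na a), εH ((1 : R) ⊗ₜ[k] a2 a i) • (f ⊗ₜ[k] a1 a i)
          = f ⊗ₜ[k] a)
    -- `S_H` is an algebra anti-isomorphism with `S_H ∘ ι = ι`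
    ∧ Function.Bijective SH
    ∧ (∀ x y : R ⊗[k] A, SH (mulH x y) = mulH (SH y) (SH x))
    ∧ (∀ f : R, SH (f ⊗ₜ[k] (1 : A)) = f ⊗ₜ[k] (1 : A))
    -- the antipode identities
    ∧ (∀ (f : R) (a : A),
        ∑ i ∈ Finset.range (na a), mulH (SH (f ⊗ₜ[k] a1 a i)) ((1 : R) ⊗ₜ[k] a2 a i)
          = εH (SH (f ⊗ₜ[k] a)) ⊗ₜ[k] (1 : A))
    ∧ (∀ (f : R) (a : A),
        ∑ i ∈ Finset.range (na a), mulH (f ⊗ₜ[k] a1 a i) (SH ((1 : R) ⊗ₜ[k] a2 a i))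
          = (Coalgebra.counit (R := k) a • f) ⊗ₜ[k] (1 : A)) := by
  classical
  -- bundle the action and the antipode as linear maps
  have act_smul_right : ∀ (c : k) (a : A) (f : R), act a (c • f) = c • act a f := by
    intro c a f
    have h1 : c • f = act (c • 1) f := by rw [act_smul, act_one]
    rw [h1, ← act_mul, mul_smul_comm, mul_one, act_smul]
  obtain ⟨L, hL⟩ : ∃ L : A →ₗ[k] R →ₗ[k] R, ∀ a f, act a f = L a f :=
    ⟨LinearMap.mk₂ k act act_add_left act_smul act_add_right act_smul_right, fun _ _ => rfl⟩
  obtain ⟨T, hT⟩ : ∃ T : R ⊗[k] A →ₗ[k] R ⊗[k] A, ∀ x, SH x = T x :=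
    ⟨⟨⟨SH, hSH_add⟩, hSH_smul⟩, fun _ => rfl⟩
  simp only [hL] at act_mul act_one act_mul_right act_one_right hmul hS
  simp only [hT] at hS
  have hbij : Function.Bijective SH ↔ Function.Bijective T := by
    rw [show SH = T from funext hT]
  simp only [hT, hbij]
  clear act_smul_right act_add_left act_add_right act_smul hSH_add hSH_smul hL hbij
  -- basic multiplication rules
  have mul_iota : ∀ (f g : R) (b : A), mulH (f ⊗ₜ[k] (1 : A)) (g ⊗ₜ[k] b) = (f * g) ⊗ₜ[k] b := by
    intro f g b
    rw [hmul, sw_one hrepr (fun x y => (f * L x g) ⊗ₜ[k] (y * b))]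
    simp [act_one]
  have mul_j : ∀ (f : R) (a b : A), mulH (f ⊗ₜ[k] a) ((1 : R) ⊗ₜ[k] b) = f ⊗ₜ[k] (a * b) := by
    intro f a b
    rw [hmul]
    conv_rhs => rw [← sw_counit_left hrepr a]
    simp only [act_one_right, Finset.sum_mul, TensorProduct.tmul_sum, ← Algebra.commutes,
      ← Algebra.smul_def, smul_mul_assoc, TensorProduct.tmul_smul, TensorProduct.smul_tmul']
  have split : ∀ (f : R) (a : A),
      f ⊗ₜ[k] a = mulH (f ⊗ₜ[k] (1 : A)) ((1 : R) ⊗ₜ[k] a) := by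
    intro f a
    rw [mul_iota, mul_one]
  have assoc : ∀ x y z : R ⊗[k] A, mulH (mulH x y) z = mulH x (mulH y z) := by
    intro x y z
    induction x with
    | zero => simp
    | add x x' hx hx' => simp [hx, hx']
    | tmul f a =>
    induction y with
    | zero => simp
    | add x x' hx hx' => simp [hx, hx']
    | tmul g b =>
    induction z with
    | zero => simp
    | add x x' hx hx' => simp [hx, hx']
    | tmul h c =>
      simp only [hmul, map_sum, LinearMap.sum_apply]
      have e1 : ∀ i, ∑ l ∈ Finset.range (na (a2 a i * b)),
          (f * L (a1 a i) g * L (a1 (a2 a i * b) l) h) ⊗ₜ[k] (a2 (a2 a i * b) l * c)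
          = ∑ i' ∈ Finset.range (na (a2 a i)), ∑ j ∈ Finset.range (na b),
            (f * L (a1 a i) g * L (a1 (a2 a i) i' * a1 b j) h) ⊗ₜ[k]
              (a2 (a2 a i) i' * a2 b j * c) := fun i =>
        sw_mul hrepr (a2 a i) b (fun x y => (f * L (a1 a i) g * L x h) ⊗ₜ[k] (y * c))
      simp only [e1]
      rw [← sw_coassoc hrepr a (fun x y z => ∑ j ∈ Finset.range (na b),
        (f * L x g * L (y * a1 b j) h) ⊗ₜ[k] (z * a2 b j * c))]
      simp only [act_mul_right, Finset.mul_sum, TensorProduct.sum_tmul, act_mul, mul_assoc]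
      rw [Finset.sum_comm]
      refine Finset.sum_congr rfl fun i _ => ?_
      rw [Finset.sum_comm]
  have one_left : ∀ x : R ⊗[k] A, mulH ((1 : R) ⊗ₜ[k] (1 : A)) x = x := by
    intro x
    induction x with
    | zero => simp
    | add x x' hx hx' => simp [hx, hx']
    | tmul f a => rw [mul_iota, one_mul]
  have one_right : ∀ x : R ⊗[k] A, mulH x ((1 : R) ⊗ₜ[k] (1 : A)) = x := by
    intro x
    induction x with
    | zero => simp
    | add x x' hx hx' => simp [hx, hx']
    | tmul f a => rw [mul_j, mul_one]
  -- the commutation rule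
  have comm_rule : ∀ (a : A) (g : R), mulH ((1 : R) ⊗ₜ[k] a) (g ⊗ₜ[k] (1 : A))
      = ∑ i ∈ Finset.range (na a), L (a1 a i) g ⊗ₜ[k] a2 a i := by
    intro a g
    simp [hmul]
  have Q : ∀ (b : A) (g : R), ∑ i ∈ Finset.range (na b),
      mulH (mulH ((1 : R) ⊗ₜ[k] a1 b i) (g ⊗ₜ[k] (1 : A)))
        ((1 : R) ⊗ₜ[k] HopfAlgebra.antipode (R := k) (a2 b i)) = L b g ⊗ₜ[k] (1 : A) := by
    intro b g
    simp only [comm_rule, map_sum, LinearMap.sum_apply, mul_j]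
    rw [sw_coassoc hrepr b
      (fun x y z => L x g ⊗ₜ[k] (y * HopfAlgebra.antipode (R := k) z))]
    simp only [← TensorProduct.tmul_sum, sw_antipode_right hrepr]
    conv_rhs => rw [← sw_counit_right hrepr b]
    simp [TensorProduct.sum_tmul, TensorProduct.smul_tmul']
  have P : ∀ (a : A) (g : R), ∑ i ∈ Finset.range (na a),
      mulH ((1 : R) ⊗ₜ[k] HopfAlgebra.antipode (R := k) (a1 a i)) (L (a2 a i) g ⊗ₜ[k] (1 : A))
        = g ⊗ₜ[k] HopfAlgebra.antipode (R := k) a := by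
    intro a g
    have h := sw_coassoc hrepr a (fun x y z =>
      mulH ((1 : R) ⊗ₜ[k] HopfAlgebra.antipode (R := k) x)
        (mulH (mulH ((1 : R) ⊗ₜ[k] y) (g ⊗ₜ[k] (1 : A)))
          ((1 : R) ⊗ₜ[k] HopfAlgebra.antipode (R := k) z)))
    simp only [← map_sum, Q] at h
    rw [← h]
    simp only [← assoc, mul_j]
    simp only [← LinearMap.sum_apply, ← map_sum, ← TensorProduct.tmul_sum,
      sw_antipode_left hrepr]
    simp only [TensorProduct.tmul_smul, map_smul, LinearMap.smul_apply, one_left, mul_j, one_mul]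
    conv_rhs => rw [← sw_counit_left hrepr a]
    simp [TensorProduct.tmul_sum, TensorProduct.tmul_smul]
  have P' : ∀ (a : A) (g : R), ∑ i ∈ Finset.range (na a),
      mulH ((1 : R) ⊗ₜ[k] HopfAlgebra.antipode (R := k) (a2 a i)) (L (a1 a i) g ⊗ₜ[k] (1 : A))
        = g ⊗ₜ[k] HopfAlgebra.antipode (R := k) a := by
    intro a g
    rw [← P a g, sw_comm hrepr hcc a (fun x y =>
      mulH ((1 : R) ⊗ₜ[k] HopfAlgebra.antipode (R := k) x) (L y g ⊗ₜ[k] (1 : A)))]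
  have hTj : ∀ (f : R) (a : A), T (f ⊗ₜ[k] a)
      = mulH ((1 : R) ⊗ₜ[k] HopfAlgebra.antipode (R := k) a) (f ⊗ₜ[k] (1 : A)) := by
    intro f a
    rw [hS, sw_comm hrepr hcc a (fun x y => L (HopfAlgebra.antipode (R := k) x) f ⊗ₜ[k]
      HopfAlgebra.antipode (R := k) y)]
    simp only [← P _ (L (HopfAlgebra.antipode (R := k) _) f), ← act_mul]
    rw [sw_coassoc hrepr a (fun x y z =>
      mulH ((1 : R) ⊗ₜ[k] HopfAlgebra.antipode (R := k) x)
        (L (y * HopfAlgebra.antipode (R := k) z) f ⊗ₜ[k] (1 : A)))]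
    simp only [← map_sum, ← TensorProduct.sum_tmul, ← LinearMap.sum_apply,
      sw_antipode_right hrepr]
    conv_rhs => rw [← sw_counit_right hrepr a]
    simp [TensorProduct.tmul_sum, ← TensorProduct.smul_tmul', act_one]
  have Tiota : ∀ f : R, T (f ⊗ₜ[k] (1 : A)) = f ⊗ₜ[k] (1 : A) := by
    intro f
    rw [hTj, HopfAlgebra.antipode_one, one_left]
  have Tj : ∀ a : A, T ((1 : R) ⊗ₜ[k] a) = (1 : R) ⊗ₜ[k] HopfAlgebra.antipode (R := k) a := by
    intro a
    rw [hTj, one_right]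
  have Tanti : ∀ x y : R ⊗[k] A, T (mulH x y) = mulH (T y) (T x) := by
    intro x y
    induction x with
    | zero => simp
    | add x x' hx hx' => simp [hx, hx']
    | tmul f a =>
    induction y with
    | zero => simp
    | add x x' hx hx' => simp [hx, hx']
    | tmul g b =>
      rw [hmul, map_sum]
      have e : ∀ i, T ((f * L (a1 a i) g) ⊗ₜ[k] (a2 a i * b))
          = mulH ((1 : R) ⊗ₜ[k] HopfAlgebra.antipode (R := k) b)
            (mulH (mulH ((1 : R) ⊗ₜ[k] HopfAlgebra.antipode (R := k) (a2 a i))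
              (L (a1 a i) g ⊗ₜ[k] (1 : A))) (f ⊗ₜ[k] (1 : A))) := by
        intro i
        rw [hTj, HopfAlgebra.antipode_mul_antidistrib, ← mul_j, mul_comm f, ← mul_iota]
        simp only [assoc]
      simp only [e]
      simp only [← map_sum, ← LinearMap.sum_apply, P']
      rw [hTj, hTj, split g]
      simp only [assoc]
  have Tsq : ∀ x : R ⊗[k] A, T (T x) = x := by
    intro x
    induction x with
    | zero => simp
    | add x x' hx hx' => simp [hx, hx']
    | tmul f a =>
      rw [hTj, Tanti, Tiota, Tj, sw_antipode_sq hrepr hcc, ← split]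
  have εT : ∀ (f : R) (a : A),
      εH (T (f ⊗ₜ[k] a)) = L (HopfAlgebra.antipode (R := k) a) f := by
    intro f a
    rw [hS, map_sum]
    simp only [hε, HopfAlgebra.counit_antipode]
    conv_rhs => rw [← sw_counit_right hrepr a]
    simp
  refine ⟨assoc, one_left, one_right, fun f g => mul_iota f g 1, ?_, ?_, ?_, ?_, ?_, ?_, ?_, ?_,
    ?_, ⟨?_, ?_⟩, Tanti, Tiota, ?_, ?_⟩
  · intro f x
    induction x with
    | zero => simp
    | add x x' hx hx' => simp [hx, hx']
    | tmul g b => rw [mul_iota, TensorProduct.smul_tmul', smul_eq_mul]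
  · intro x
    induction x with
    | zero => simp
    | add x x' hx hx' => simp only [map_add, hx, hx']
    | tmul f a =>
      simp only [hΔ, map_sum, TensorProduct.map_tmul, LinearMap.id_apply,
        TensorProduct.sum_tmul, TensorProduct.tmul_sum, TensorProduct.assoc_tmul]
      exact sw_coassoc hrepr a (fun x y z => (f ⊗ₜ[k] x) ⊗ₜ[R]
        (((1 : R) ⊗ₜ[k] y) ⊗ₜ[R] ((1 : R) ⊗ₜ[k] z)))
  · intro f g a
    simp only [hmul, TensorProduct.sum_tmul, TensorProduct.tmul_sum, mul_one, one_mul]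
    have e : ∀ (x y z : A), (f ⊗ₜ[k] x) ⊗ₜ[R] (L y g ⊗ₜ[k] z)
        = ((f * L y g) ⊗ₜ[k] x) ⊗ₜ[R] ((1 : R) ⊗ₜ[k] z) := by
      intro x y z
      have h1 : L y g ⊗ₜ[k] z = L y g • ((1 : R) ⊗ₜ[k] z) := by
        rw [TensorProduct.smul_tmul', smul_eq_mul, mul_one]
      rw [h1, ← TensorProduct.smul_tmul, TensorProduct.smul_tmul', smul_eq_mul, mul_comm]
    simp only [e]
    rw [← sw_coassoc hrepr a (fun x y z =>
      ((f * L y g) ⊗ₜ[k] x) ⊗ₜ[R] ((1 : R) ⊗ₜ[k] z))]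
    refine Finset.sum_congr rfl fun i _ => ?_
    exact sw_comm hrepr hcc (a1 a i) (fun x y =>
      ((f * L x g) ⊗ₜ[k] y) ⊗ₜ[R] ((1 : R) ⊗ₜ[k] a2 a i))
  · intro f g a b
    simp only [mul_j]
    simp only [hmul, map_sum, hΔ]
    have e1 : ∀ i, ∑ l ∈ Finset.range (na (a2 a i * b)),
        ((f * L (a1 a i) g) ⊗ₜ[k] (a1 (a2 a i * b) l)) ⊗ₜ[R]
          ((1 : R) ⊗ₜ[k] a2 (a2 a i * b) l)
        = ∑ i' ∈ Finset.range (na (a2 a i)), ∑ j ∈ Finset.range (na b),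
          ((f * L (a1 a i) g) ⊗ₜ[k] (a1 (a2 a i) i' * a1 b j)) ⊗ₜ[R]
          ((1 : R) ⊗ₜ[k] (a2 (a2 a i) i' * a2 b j)) := fun i =>
      sw_mul hrepr (a2 a i) b (fun x y => ((f * L (a1 a i) g) ⊗ₜ[k] x) ⊗ₜ[R]
          ((1 : R) ⊗ₜ[k] y))
    simp only [e1]
    rw [← sw_coassoc hrepr a (fun x y z => ∑ j ∈ Finset.range (na b),
      ((f * L x g) ⊗ₜ[k] (y * a1 b j)) ⊗ₜ[R] ((1 : R) ⊗ₜ[k] (z * a2 b j)))]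
    refine Finset.sum_congr rfl fun i _ => ?_
    rw [Finset.sum_comm]
    simp only [TensorProduct.sum_tmul]
  · rw [hΔ]
    exact sw_one hrepr (fun x y => ((1 : R) ⊗ₜ[k] x) ⊗ₜ[R] ((1 : R) ⊗ₜ[k] y))
  · rw [hε]; simp
  · intro x y
    rw [map_sub, map_sub, sub_eq_zero]
    induction x with
    | zero => simp
    | add x x' hx hx' => simp only [map_add, LinearMap.add_apply, hx, hx']
    | tmul f a =>
    induction y with
    | zero => simp
    | add x x' hx hx' => simp only [map_add, TensorProduct.add_tmul, hx, hx']
    | tmul g b =>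
      simp only [hmul, hε, map_sum, Bialgebra.counit_mul, Bialgebra.counit_one, mul_one,
        map_smul, mul_smul_comm, mul_smul, Finset.smul_sum]
  · intro f a
    conv_rhs => rw [← sw_counit_left hrepr a]
    simp only [hε, TensorProduct.tmul_sum]
    refine Finset.sum_congr rfl fun i _ => ?_
    rw [TensorProduct.smul_tmul', smul_eq_mul, mul_one, TensorProduct.smul_tmul]
  · intro f a
    conv_rhs => rw [← sw_counit_right hrepr a]
    simp only [hε, TensorProduct.tmul_sum]
    refine Finset.sum_congr rfl fun i _ => ?_
    rw [TensorProduct.smul_tmul', smul_eq_mul, smul_mul_assoc, one_mul, TensorProduct.smul_tmul]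
  · exact Function.LeftInverse.injective Tsq
  · exact Function.RightInverse.surjective Tsq
  · intro f a
    rw [εT]
    simp only [hS, map_sum, LinearMap.sum_apply, mul_j]
    rw [sw_coassoc hrepr a (fun x y z => L (HopfAlgebra.antipode (R := k) x) f ⊗ₜ[k]
      (HopfAlgebra.antipode (R := k) y * z))]
    simp only [← TensorProduct.tmul_sum, sw_antipode_left hrepr]
    conv_rhs => rw [← sw_counit_right hrepr a]
    simp [TensorProduct.sum_tmul, TensorProduct.smul_tmul']
  · intro f a
    simp only [Tj, mul_j]
    rw [← TensorProduct.tmul_sum, sw_antipode_right hrepr, TensorProduct.smul_tmul]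
end

section
/- Let (A, ▷) be a cocommutative post-Hopf algebra over k and let the commutative k-algebra R be a module algebra over the sub-adjacent Hopf algebra A_▷ via ⇀, i.e. (a *_▷ b) ⇀ f = a ⇀ (b ⇀ f), 1 ⇀ f = f, a ⇀ (fg) = (a₁ ⇀ f)(a₂ ⇀ g), a ⇀ 1 = ε(a)·1. On the tensor product Hopf R-algebra H = R ⊗ A define (f ⊗ a) ⊵ (g ⊗ b) := f(a₁ ⇀ g) ⊗ (a₂ ▷ b). Then (H, ι, ⊵) is a weak post-Hopf algebroid over R, i.e. ⊵ satisfies all seven weak post-Hopf algebroid axioms. -/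
open scoped TensorProduct

set_option maxSynthPendingDepth 3

/-- A post-Hopf algebra `(A, ▷)` over `k` (Li–Sheng–Tang): a Hopf algebra `A` with a
coalgebra homomorphism `▷ : A ⊗ A → A` satisfying `a ▷ (bc) = (a₁ ▷ b)(a₂ ▷ c)` and
`a ▷ (b ▷ c) = (a₁(a₂ ▷ b)) ▷ c`, whose left multiplication is convolution invertible.
The coproduct of `A` is handled through a chosen Sweedler representation
`Δ(a) = ∑ c1 a i ⊗ c2 a i`. -/
structure PostHopfAlgebra (k A : Type*) [Field k] [CharZero k]
    [Ring A] [HopfAlgebra k A] where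
  /-- the post-Hopf product `▷` -/
  tr : A → A → A
  n : A → ℕ
  c1 : A → ℕ → A
  c2 : A → ℕ → A
  repr : ∀ a : A, Coalgebra.comul (R := k) a
      = ∑ i ∈ Finset.range (n a), c1 a i ⊗ₜ[k] c2 a i
  tr_add_left : ∀ a b c : A, tr (a + b) c = tr a c + tr b c
  tr_add_right : ∀ a b c : A, tr a (b + c) = tr a b + tr a c
  tr_smul_left : ∀ (s : k) (a b : A), tr (s • a) b = s • tr a b
  tr_smul_right : ∀ (s : k) (a b : A), tr a (s • b) = s • tr a b
  /-- `▷` is a coalgebra homomorphism: compatibility with the counit -/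
  counit_tr : ∀ a b : A, Coalgebra.counit (R := k) (tr a b)
      = Coalgebra.counit (R := k) a * Coalgebra.counit (R := k) b
  /-- `▷` is a coalgebra homomorphism: compatibility with the coproduct -/
  comul_tr : ∀ a b : A, Coalgebra.comul (R := k) (tr a b)
      = ∑ i ∈ Finset.range (n a), ∑ j ∈ Finset.range (n b),
          tr (c1 a i) (c1 b j) ⊗ₜ[k] tr (c2 a i) (c2 b j)
  /-- `a ▷ (bc) = (a₁ ▷ b)(a₂ ▷ c)` -/
  tr_mul : ∀ a b c : A, tr a (b * c)
      = ∑ i ∈ Finset.range (n a), tr (c1 a i) b * tr (c2 a i) c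
  /-- `a ▷ (b ▷ c) = (a₁(a₂ ▷ b)) ▷ c` -/
  tr_tr : ∀ a b c : A, tr a (tr b c)
      = tr (∑ i ∈ Finset.range (n a), c1 a i * tr (c2 a i) b) c
  /-- the convolution inverse `β` of the left multiplication `α_▷` -/
  beta : A → A → A
  beta_conv_left : ∀ a x : A,
    ∑ i ∈ Finset.range (n a), tr (c1 a i) (beta (c2 a i) x)
      = Coalgebra.counit (R := k) a • x
  beta_conv_right : ∀ a x : A,
    ∑ i ∈ Finset.range (n a), beta (c1 a i) (tr (c2 a i) x)
      = Coalgebra.counit (R := k) a • x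

/-- The Grossman–Larson product `a *_▷ b = a₁(a₂ ▷ b)` of the sub-adjacent Hopf
algebra `A_▷`. -/
def PostHopfAlgebra.gl {k A : Type*} [Field k] [CharZero k]
    [Ring A] [HopfAlgebra k A] (P : PostHopfAlgebra k A) (a b : A) : A :=
  ∑ i ∈ Finset.range (P.n a), P.c1 a i * P.tr (P.c2 a i) b

/-- The antipode `S_▷(a) = β_{▷,a₁}(S(a₂))` of the sub-adjacent Hopf algebra `A_▷`. -/
noncomputable def PostHopfAlgebra.SA {k A : Type*} [Field k] [CharZero k]
    [Ring A] [HopfAlgebra k A] (P : PostHopfAlgebra k A) (a : A) : A :=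
  ∑ i ∈ Finset.range (P.n a), P.beta (P.c1 a i) (HopfAlgebra.antipode (R := k) (P.c2 a i))

namespace PHaux

section
variable {k A M : Type*} [Field k] [CharZero k] [Ring A] [HopfAlgebra k A]
  [AddCommGroup M] [Module k M] (P : PostHopfAlgebra k A)

/-- Sweedler sum. -/
def D (B : A → A → M) (a : A) : M :=
  ∑ i ∈ Finset.range (P.n a), B (P.c1 a i) (P.c2 a i)

/-- Bilinearity. -/
structure Bil (k : Type*) {A M : Type*} [Field k] [Ring A] [Module k A]
    [AddCommGroup M] [Module k M] (B : A → A → M) : Prop where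
  l : ∀ b, IsLinearMap k (fun a => B a b)
  r : ∀ a, IsLinearMap k (fun b => B a b)

/-- Bundled bilinear map. -/
def bl {B : A → A → M} (h : Bil k B) : A →ₗ[k] A →ₗ[k] M :=
  LinearMap.mk₂ k B (fun x y b => (h.l b).map_add x y) (fun c x b => (h.l b).map_smul c x)
    (fun a x y => (h.r a).map_add x y) (fun c a x => (h.r a).map_smul c x)

theorem D_eq {B : A → A → M} (h : Bil k B) (a : A) :
    D P B a = TensorProduct.lift (bl h) (Coalgebra.comul (R := k) a) := by
  rw [P.repr a, map_sum]
  simp [D, bl]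

theorem D_lin {B : A → A → M} (h : Bil k B) : IsLinearMap k (D P B) := by
  constructor <;> intros <;> simp [D_eq P h]

theorem D_cc (hcc : ∀ a : A, (TensorProduct.comm k A A) (Coalgebra.comul (R := k) a)
        = Coalgebra.comul (R := k) a) {B : A → A → M} (h : Bil k B) (a : A) :
    D P (fun x y => B y x) a = D P B a := by
  rw [D_eq P h, ← hcc, P.repr a]
  simp [D, bl]

theorem D_coassoc {F : A → A → A → M} (h1 : ∀ z, Bil k (fun x y => F x y z))
    (h2 : ∀ x, Bil k (fun y z => F x y z)) (a : A) :
    D P (fun u z => D P (fun x y => F x y z) u) a = D P (fun x v => D P (fun y z => F x y z) v) a := by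
  let T : A →ₗ[k] A →ₗ[k] A →ₗ[k] M := LinearMap.mk₂ k (fun x y => IsLinearMap.mk' _ ((h2 x).r y))
    (fun x y b => by ext z; exact ((h1 z).l b).map_add x y)
    (fun c x b => by ext z; exact ((h1 z).l b).map_smul c x)
    (fun a x y => by ext z; exact ((h1 z).r a).map_add x y)
    (fun c a x => by ext z; exact ((h1 z).r a).map_smul c x)
  have key := congrArg (TensorProduct.lift ((TensorProduct.lift.equiv (.id k) A A (A →ₗ[k] M)) T))
    (congrArg (TensorProduct.assoc k A A A).symm (Coalgebra.coassoc_apply (R := k) a))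
  rw [LinearEquiv.symm_apply_apply, P.repr a] at key
  simp only [map_sum, LinearMap.rTensor_tmul, LinearMap.lTensor_tmul, P.repr,
    TensorProduct.sum_tmul, TensorProduct.tmul_sum, TensorProduct.assoc_symm_tmul,
    TensorProduct.lift.tmul, TensorProduct.lift.equiv_apply] at key
  exact key

theorem D_congr {B B' : A → A → M} (h : ∀ x y, B x y = B' x y) (a : A) : D P B a = D P B' a := by
  simp [D, h]

theorem D_one {B : A → A → M} (h : Bil k B) : D P B 1 = B 1 1 := by
  rw [D_eq P h, Bialgebra.comul_one]; simp [bl, Algebra.TensorProduct.one_def]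

theorem D_mul {B : A → A → M} (h : Bil k B) (x y : A) :
    D P B (x * y) = D P (fun x1 x2 => D P (fun y1 y2 => B (x1 * y1) (x2 * y2)) y) x := by
  rw [D_eq P h, Bialgebra.comul_mul, P.repr x, P.repr y]
  simp [D, bl, Finset.sum_mul_sum]

theorem D_tr {B : A → A → M} (h : Bil k B) (x y : A) :
    D P B (P.tr x y) = D P (fun x1 x2 => D P (fun y1 y2 => B (P.tr x1 y1) (P.tr x2 y2)) y) x := by
  rw [D_eq P h, P.comul_tr]
  simp [D, bl]

theorem D_counit_l {G : A → M} (h : IsLinearMap k G) (a : A) :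
    D P (fun x y => Coalgebra.counit (R := k) x • G y) a = G a := by
  have := congrArg (fun t => h.mk' G (TensorProduct.lid k A t))
    (Coalgebra.rTensor_counit_comul (R := k) a)
  simpa [P.repr a, D] using this

theorem D_counit_r {G : A → M} (h : IsLinearMap k G) (a : A) :
    D P (fun x y => Coalgebra.counit (R := k) y • G x) a = G a := by
  have := congrArg (fun t => h.mk' G (TensorProduct.rid k A t))
    (Coalgebra.lTensor_counit_comul (R := k) a)
  simpa [P.repr a, D] using this

theorem lin_D {N : Type*} [AddCommGroup N] [Module k N] {F : N → A → A → M}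
    (h : ∀ x y, IsLinearMap k (fun t => F t x y)) (a : A) :
    IsLinearMap k (fun t => D P (F t) a) := by
  constructor
  · intro s t
    simp only [D, ← Finset.sum_add_distrib]
    exact Finset.sum_congr rfl fun i _ => (h _ _).map_add s t
  · intro c t
    simp only [D, Finset.smul_sum]
    exact Finset.sum_congr rfl fun i _ => (h _ _).map_smul c t

/-- Quadrilinear. -/
structure Quad (k : Type*) {A M : Type*} [Field k] [Ring A] [Module k A]
    [AddCommGroup M] [Module k M] (F : A → A → A → A → M) : Prop where
  a : ∀ y z w, IsLinearMap k (fun x => F x y z w)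
  b : ∀ x z w, IsLinearMap k (fun y => F x y z w)
  c : ∀ x y w, IsLinearMap k (fun z => F x y z w)
  d : ∀ x y z, IsLinearMap k (fun w => F x y z w)

theorem D_expand {F : A → A → A → A → M} (h : Quad k F) (a : A) :
    D P (fun u v => D P (fun x y => D P (fun z w => F x y z w) v) u) a =
    D P (fun x v => D P (fun u w => D P (fun y z => F x y z w) u) v) a := by
  rw [D_coassoc P (F := fun x y v => D P (fun z w => F x y z w) v)]
  · refine D_congr P (fun x v => ?_) a
    rw [← D_coassoc P (F := fun y z w => F x y z w)]
    · exact fun w => ⟨fun z => h.b _ _ _, fun y => h.c _ _ _⟩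
    · exact fun y => ⟨fun w => h.c _ _ _, fun z => h.d _ _ _⟩
  · exact fun v => ⟨fun y => lin_D P (fun _ _ => h.a _ _ _) _,
      fun x => lin_D P (fun _ _ => h.b _ _ _) _⟩
  · exact fun x => ⟨fun v => lin_D P (fun _ _ => h.b _ _ _) _,
      fun y => D_lin P ⟨fun w => h.c _ _ _, fun z => h.d _ _ _⟩⟩

theorem D_swap (hcc : ∀ a : A, (TensorProduct.comm k A A) (Coalgebra.comul (R := k) a)
        = Coalgebra.comul (R := k) a) {F : A → A → A → A → M} (h : Quad k F) (a : A) :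
    D P (fun u v => D P (fun x y => D P (fun z w => F x y z w) v) u) a =
    D P (fun u v => D P (fun x y => D P (fun z w => F x z y w) v) u) a := by
  rw [D_expand P h, D_expand P (F := fun x y z w => F x z y w) ⟨fun _ _ _ => h.a _ _ _,
    fun _ _ _ => h.c _ _ _, fun _ _ _ => h.b _ _ _, fun _ _ _ => h.d _ _ _⟩]
  refine D_congr P (fun x v => D_congr P (fun u w => ?_) v) a
  exact (D_cc P hcc (B := fun y z => F x y z w) ⟨fun z => h.b _ _ _, fun y => h.c _ _ _⟩ u).symm

theorem tr_l (b : A) : IsLinearMap k (fun a => P.tr a b) :=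
  ⟨fun _ _ => P.tr_add_left _ _ _, fun _ _ => P.tr_smul_left _ _ _⟩
theorem tr_r (a : A) : IsLinearMap k (fun b => P.tr a b) :=
  ⟨fun _ _ => P.tr_add_right _ _ _, fun _ _ => P.tr_smul_right _ _ _⟩

theorem gl_eq (a b : A) : P.gl a b = D P (fun x y => x * P.tr y b) a := rfl

theorem gl_l (b : A) : IsLinearMap k (fun a => P.gl a b) := by
  refine D_lin P (B := fun x y => x * P.tr y b) ⟨fun b => ?_, fun a => ?_⟩ <;> constructor <;> intros <;>
    simp [add_mul, mul_add, P.tr_add_left, P.tr_smul_left]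

theorem gl_r (a : A) : IsLinearMap k (fun b => P.gl a b) := by
  refine lin_D P (F := fun b x y => x * P.tr y b) ?_ a
  intro x y; constructor <;> intros <;> simp [mul_add, P.tr_add_right, P.tr_smul_right]

theorem D_sum {B : A → A → M} (h : Bil k B) (F : A → A → A) (a : A) :
    D P B (D P F a) = D P (fun x y => D P B (F x y)) a :=
  map_sum ((D_lin P h).mk' _) _ _

theorem D_gl (hcc : ∀ a : A, (TensorProduct.comm k A A) (Coalgebra.comul (R := k) a)
        = Coalgebra.comul (R := k) a) {B : A → A → M} (h : Bil k B) (a b : A) :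
    D P B (P.gl a b) = D P (fun x1 x2 => D P (fun y1 y2 => B (P.gl x1 y1) (P.gl x2 y2)) b) a := by
  have bal : ∀ x y x', B (x + y) x' = B x x' + B y x' := fun x y x' => (h.l x').map_add x y
  have bar : ∀ x y x', B x' (x + y) = B x' x + B x' y := fun x y x' => (h.r x').map_add x y
  have bsl : ∀ (c : k) x x', B (c • x) x' = c • B x x' := fun c x x' => (h.l x').map_smul c x
  have bsr : ∀ (c : k) x x', B x' (c • x) = c • B x' x := fun c x x' => (h.r x').map_smul c x
  rw [gl_eq, D_sum P h]
  have e1 : ∀ x y, D P B (x * P.tr y b) = D P (fun x1 x2 => D P (fun y1 y2 =>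
      D P (fun b1 b2 => B (x1 * P.tr y1 b1) (x2 * P.tr y2 b2)) b) y) x := by
    intro x y
    rw [D_mul P h]
    refine D_congr P (fun x1 x2 => ?_) x
    rw [D_tr P]
    constructor <;> intro <;> constructor <;> intros <;> simp [mul_add, *]
  rw [D_congr P e1, D_swap P hcc (F := fun x1 x2 y1 y2 =>
      D P (fun b1 b2 => B (x1 * P.tr y1 b1) (x2 * P.tr y2 b2)) b)]
  · refine D_congr P (fun u v => ?_) a
    have e2 : ∀ b1 b2, B (P.gl u b1) (P.gl v b2) =
        D P (fun x y => D P (fun z w => B (x * P.tr y b1) (z * P.tr w b2)) v) u := by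
      intro b1 b2
      rw [gl_eq, gl_eq]
      refine (map_sum ((h.l _).mk' _) _ _).trans ?_
      exact Finset.sum_congr rfl fun i _ => map_sum ((h.r _).mk' _) _ _
    rw [D_congr P e2]
    simp only [D]
    rw [Finset.sum_comm]
    conv_rhs => rw [Finset.sum_comm]
    rw [Finset.sum_comm]
    refine Finset.sum_congr rfl fun i _ => ?_
    rw [Finset.sum_comm]
  · constructor <;> intro _ _ _ <;> refine lin_D P (fun _ _ => ?_) b <;> constructor <;> intros <;>
      simp [mul_add, add_mul, P.tr_add_left, P.tr_smul_left, *]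

theorem tr_one (a : A) : P.tr a 1 = Coalgebra.counit (R := k) a • 1 := by
  let S : A →ₗ[k] A := HopfAlgebra.antipode (R := k) (A := A)
  have hS : ∀ a : A, D P (fun x y => S x * y) a = Coalgebra.counit (R := k) a • 1 := by
    intro a
    have := HopfAlgebra.mul_antipode_rTensor_comul_apply (R := k) a
    rw [P.repr a] at this
    simpa [D, S, Algebra.algebraMap_eq_smul_one] using this
  have bS : Bil k (fun x y : A => S x * y) := by
    constructor <;> intro <;> constructor <;> intros <;> simp [mul_add, add_mul]
  have h2 : ∀ a, D P (fun x y => S (P.tr x 1) * P.tr y 1) a = Coalgebra.counit (R := k) a • 1 := by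
    intro a
    have := hS (P.tr a 1)
    rw [D_tr P bS, P.counit_tr, Bialgebra.counit_one, mul_one] at this
    rw [← this]
    refine D_congr P (fun x y => ?_) a
    rw [D_one P]
    constructor <;> intro <;> constructor <;> intros <;>
      simp [mul_add, add_mul, P.tr_add_right, P.tr_smul_right]
  have h3 : ∀ a, P.tr a 1 = D P (fun x y => P.tr x 1 * P.tr y 1) a := by
    intro a
    conv_lhs => rw [← mul_one (1 : A)]
    exact P.tr_mul a 1 1
  have h4 := D_coassoc P (F := fun x y z => S (P.tr x 1) * P.tr y 1 * P.tr z 1)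
    (by intro; constructor <;> intro <;> constructor <;> intros <;>
          simp [mul_add, add_mul, P.tr_add_left, P.tr_smul_left])
    (by intro; constructor <;> intro <;> constructor <;> intros <;>
          simp [mul_add, add_mul, P.tr_add_left, P.tr_smul_left]) a
  have e1 : ∀ u z, D P (fun x y => S (P.tr x 1) * P.tr y 1 * P.tr z 1) u
      = Coalgebra.counit (R := k) u • P.tr z 1 := by
    intro u z
    rw [← one_mul (P.tr z 1), ← smul_mul_assoc, ← h2 u]
    simp [D, Finset.sum_mul]
  have e2 : ∀ x v, D P (fun y z => S (P.tr x 1) * P.tr y 1 * P.tr z 1) v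
      = S (P.tr x 1) * P.tr v 1 := by
    intro x v
    rw [h3 v]
    simp [D, Finset.mul_sum, mul_assoc]
  rw [D_congr P e1, D_congr P e2, h2, D_counit_l P (G := fun z => P.tr z 1) (tr_l P 1)] at h4
  exact h4

theorem gl_one (a : A) : P.gl a 1 = a := by
  rw [gl_eq]
  refine Eq.trans (D_congr P (B' := fun x y => Coalgebra.counit (R := k) y • x) ?_ a)
    (D_counit_r P (G := fun x => x) ⟨fun _ _ => rfl, fun _ _ => rfl⟩ a)
  intro x y
  simp [tr_one]

theorem one_tr (x : A) : P.tr 1 x = x := by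
  have h1 : ∀ a x, P.tr a (P.tr 1 x) = P.tr a x := by
    intro a x
    rw [P.tr_tr]
    exact congrArg (fun t => P.tr t x) (gl_one P a)
  have h2 := P.beta_conv_right 1 (P.tr 1 x)
  simp only [h1] at h2
  rw [P.beta_conv_right 1 x] at h2
  simpa using h2.symm

end
end PHaux

set_option linter.unusedSimpArgs false

/-- let `(A, ▷)` be a cocommutative post-Hopf algebra over `k` and let `R`
be a module algebra over the sub-adjacent Hopf algebra `A_▷` via `⇀`.  On the tensor
product Hopf `R`-algebra `H = R ⊗ A` (with unit map `ι(f) = f ⊗ 1`, coproduct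
`Δ_H(f ⊗ a) = (f ⊗ a₁) ⊗_R (1 ⊗ a₂)`, counit `ε_H(f ⊗ a) = f·ε(a)` and antipode
`S_H(f ⊗ a) = f ⊗ S(a)`) the product `(f ⊗ a) ⊵ (g ⊗ b) = f(a₁ ⇀ g) ⊗ (a₂ ▷ b)` makes
`(H, ι, ⊵)` a weak post-Hopf algebroid over `R`: it satisfies all seven axioms. -/
theorem stmt8 {k R A : Type*} [Field k] [CharZero k] [CommRing R] [Algebra k R]
    [Ring A] [HopfAlgebra k A]
    (P : PostHopfAlgebra k A)
    -- `A` is cocommutative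
    (hcc : ∀ a : A, (TensorProduct.comm k A A) (Coalgebra.comul (R := k) a)
        = Coalgebra.comul (R := k) a)
    -- `R` is a module algebra over the sub-adjacent Hopf algebra `A_▷` via `⇀`
    (act : A → R → R)
    (act_add_left : ∀ (a b : A) (f : R), act (a + b) f = act a f + act b f)
    (act_add_right : ∀ (a : A) (f g : R), act a (f + g) = act a f + act a g)
    (act_smul : ∀ (c : k) (a : A) (f : R), act (c • a) f = c • act a f)
    (act_glmul : ∀ (a b : A) (f : R), act (P.gl a b) f = act a (act b f))
    (act_one : ∀ f : R, act 1 f = f)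
    (act_mul_right : ∀ (a : A) (f g : R),
      act a (f * g) = ∑ i ∈ Finset.range (P.n a), act (P.c1 a i) f * act (P.c2 a i) g)
    (act_one_right : ∀ a : A, act a 1 = algebraMap k R (Coalgebra.counit (R := k) a))
    -- the tensor product Hopf `R`-algebra structure maps on `H = R ⊗ A`
    (ΔH : (R ⊗[k] A) →ₗ[R] (R ⊗[k] A) ⊗[R] (R ⊗[k] A))
    (hΔH : ∀ (f : R) (a : A), ΔH (f ⊗ₜ[k] a)
        = ∑ i ∈ Finset.range (P.n a),
            (f ⊗ₜ[k] P.c1 a i) ⊗ₜ[R] ((1 : R) ⊗ₜ[k] P.c2 a i))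
    (εH : (R ⊗[k] A) →ₗ[R] R)
    (hεH : ∀ (f : R) (a : A), εH (f ⊗ₜ[k] a) = Coalgebra.counit (R := k) a • f)
    (SH : R ⊗[k] A → R ⊗[k] A)
    (hSH : ∀ (f : R) (a : A), SH (f ⊗ₜ[k] a) = f ⊗ₜ[k] HopfAlgebra.antipode (R := k) a)
    -- the product `⊵` on `H`
    (trH : R ⊗[k] A → R ⊗[k] A → R ⊗[k] A)
    (trH_add_left : ∀ x y z : R ⊗[k] A, trH (x + y) z = trH x z + trH y z)
    (trH_add_right : ∀ x y z : R ⊗[k] A, trH x (y + z) = trH x y + trH x z)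
    (trH_smul_right : ∀ (c : k) (x y : R ⊗[k] A), trH x (c • y) = c • trH x y)
    (htr : ∀ (f g : R) (a b : A), trH (f ⊗ₜ[k] a) (g ⊗ₜ[k] b)
        = ∑ i ∈ Finset.range (P.n a), (f * act (P.c1 a i) g) ⊗ₜ[k] P.tr (P.c2 a i) b) :
    -- axiom (1): `Δ(x ⊵ y) = (x₁ ⊵ y₁) ⊗ (x₂ ⊵ y₂)`
    (∀ (f g : R) (a b : A),
        ΔH (trH (f ⊗ₜ[k] a) (g ⊗ₜ[k] b))
          = ∑ i ∈ Finset.range (P.n a), ∑ j ∈ Finset.range (P.n b),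
              trH (f ⊗ₜ[k] P.c1 a i) (g ⊗ₜ[k] P.c1 b j)
                ⊗ₜ[R] trH ((1 : R) ⊗ₜ[k] P.c2 a i) ((1 : R) ⊗ₜ[k] P.c2 b j))
    -- axiom (2): `x ⊵ 1 = ι(ε(x))`
    ∧ (∀ x : R ⊗[k] A, trH x ((1 : R) ⊗ₜ[k] (1 : A)) = εH x ⊗ₜ[k] (1 : A))
    -- axiom (3): `1 ⊵ x = x`
    ∧ (∀ x : R ⊗[k] A, trH ((1 : R) ⊗ₜ[k] (1 : A)) x = x)
    -- axiom (4): `ι(ε(x ⊵ y)) = x ⊵ ι(ε(y))`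
    ∧ (∀ x y : R ⊗[k] A,
        εH (trH x y) ⊗ₜ[k] (1 : A) = trH x (εH y ⊗ₜ[k] (1 : A)))
    -- axiom (5): `(f·x) ⊵ y = f·(x ⊵ y)`
    ∧ (∀ (f : R) (x y : R ⊗[k] A), trH (f • x) y = f • trH x y)
    -- axiom (6): `x ⊵ (yz) = (x₁ ⊵ y)(x₂ ⊵ z)`
    ∧ (∀ (f : R) (a : A) (y z : R ⊗[k] A),
        trH (f ⊗ₜ[k] a) (y * z)
          = ∑ i ∈ Finset.range (P.n a),
              trH (f ⊗ₜ[k] P.c1 a i) y * trH ((1 : R) ⊗ₜ[k] P.c2 a i) z)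
    -- axiom (7): `x ⊵ (y ⊵ z) = (x₁(x₂ ⊵ y)) ⊵ z`
    ∧ (∀ (f : R) (a : A) (y z : R ⊗[k] A),
        trH (f ⊗ₜ[k] a) (trH y z)
          = trH (∑ i ∈ Finset.range (P.n a),
              (f ⊗ₜ[k] P.c1 a i) * trH ((1 : R) ⊗ₜ[k] P.c2 a i) y) z) := by
  have act_gl1 : ∀ (s : k) (a : A) (f : R), act a (s • f) = s • act a f := by
    intro s a f
    conv_lhs => rw [← act_one f, ← act_smul, ← act_glmul]
    rw [(PHaux.gl_r P a).map_smul, act_smul, PHaux.gl_one]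
  have one1 : ∀ x : A, P.tr x 1 = Coalgebra.counit (R := k) x • 1 := PHaux.tr_one P
  have htr' : ∀ (f g : R) (a b : A), trH (f ⊗ₜ[k] a) (g ⊗ₜ[k] b)
      = PHaux.D P (fun x y => (f * act x g) ⊗ₜ[k] P.tr y b) a := htr
  have hΔ' : ∀ (f : R) (a : A), ΔH (f ⊗ₜ[k] a)
      = PHaux.D P (fun x y => (f ⊗ₜ[k] x) ⊗ₜ[R] ((1 : R) ⊗ₜ[k] y)) a := hΔH
  have act_m : ∀ (a : A) (f g : R), act a (f * g)
      = PHaux.D P (fun x y => act x f * act y g) a := act_mul_right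
  have z1 : ∀ y, trH 0 y = 0 := fun y => by simpa using trH_add_left 0 0 y
  have z2 : ∀ y, trH y 0 = 0 := fun y => by simpa using trH_add_right y 0 0
  have hs1 : ∀ {ι : Type} (s : Finset ι) (F : ι → R ⊗[k] A) (y : R ⊗[k] A),
      trH (∑ i ∈ s, F i) y = ∑ i ∈ s, trH (F i) y := fun s F y =>
    map_sum (AddMonoidHom.mk' (fun x => trH x y) (fun _ _ => trH_add_left _ _ _)) F s
  have hs2 : ∀ {ι : Type} (s : Finset ι) (F : ι → R ⊗[k] A) (y : R ⊗[k] A),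
      trH y (∑ i ∈ s, F i) = ∑ i ∈ s, trH y (F i) := fun s F y =>
    map_sum (AddMonoidHom.mk' (fun x => trH y x) (fun _ _ => trH_add_right _ _ _)) F s
  have tw : ∀ (s : k) (u : R) (v : A), (s • u) ⊗ₜ[k] v = s • (u ⊗ₜ[k] v) := fun s u v =>
    (TensorProduct.smul_tmul' s u v).symm
  have tl : ∀ (s : k) (p q : R ⊗[k] A), (s • p) ⊗ₜ[R] q = s • (p ⊗ₜ[R] q) := fun s p q =>
    (TensorProduct.smul_tmul' s p q).symm
  have tq : ∀ (s : k) (p q : R ⊗[k] A), p ⊗ₜ[R] (s • q) = s • (p ⊗ₜ[R] q) := fun s p q => by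
    rw [← algebraMap_smul R s q, TensorProduct.tmul_smul, algebraMap_smul]
  have h1 : ∀ (f : R) (a b : A), trH (f ⊗ₜ[k] a) ((1 : R) ⊗ₜ[k] b) = f ⊗ₜ[k] P.tr a b := by
    intro f a b
    rw [htr']
    refine Eq.trans (PHaux.D_congr P (B' := fun x y =>
      Coalgebra.counit (R := k) x • (f ⊗ₜ[k] P.tr y b)) ?_ a) (PHaux.D_counit_l P (k := k)
      (G := fun y => f ⊗ₜ[k] P.tr y b) ?_ a)
    · intro x y
      rw [act_one_right, mul_comm, ← Algebra.smul_def, tw]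
    · constructor <;> intros <;>
        simp [P.tr_add_left, P.tr_smul_left, TensorProduct.tmul_add]
  have h2 : ∀ (f g : R) (a : A), trH (f ⊗ₜ[k] a) (g ⊗ₜ[k] (1 : A)) = (f * act a g) ⊗ₜ[k] (1 : A) := by
    intro f g a
    rw [htr']
    refine Eq.trans (PHaux.D_congr P (B' := fun x y =>
      Coalgebra.counit (R := k) y • ((f * act x g) ⊗ₜ[k] (1 : A))) ?_ a) (PHaux.D_counit_r P (k := k)
      (G := fun x => (f * act x g) ⊗ₜ[k] (1 : A)) ?_ a)
    · intro x y
      rw [one1, TensorProduct.tmul_smul]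
    · constructor <;> intros <;>
        simp [act_add_left, act_smul, mul_add, TensorProduct.add_tmul, tw]
  refine ⟨?_, ?_, ?_, ?_, ?_, ?_, ?_⟩
  · intro f g a b
    simp only [h1, htr']
    have L : ΔH (PHaux.D P (fun x y => (f * act x g) ⊗ₜ[k] P.tr y b) a) =
        PHaux.D P (fun x v => PHaux.D P (fun y z => PHaux.D P (fun b1 b2 =>
          ((f * act x g) ⊗ₜ[k] P.tr y b1) ⊗ₜ[R] ((1 : R) ⊗ₜ[k] P.tr z b2)) b) v) a := by
      refine (map_sum ΔH _ _).trans (PHaux.D_congr P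
        (B := fun x v => ΔH ((f * act x g) ⊗ₜ[k] P.tr v b)) (fun x v => ?_) a)
      rw [hΔ', PHaux.D_tr P (k := k)]
      constructor <;> intro <;> constructor <;> intros <;>
        simp [TensorProduct.tmul_add, TensorProduct.add_tmul, tl, tq]
    rw [L, ← PHaux.D_coassoc P (k := k) (F := fun x y z => PHaux.D P (fun b1 b2 =>
          ((f * act x g) ⊗ₜ[k] P.tr y b1) ⊗ₜ[R] ((1 : R) ⊗ₜ[k] P.tr z b2)) b)]
    · simp only [PHaux.D, TensorProduct.sum_tmul]
      refine Finset.sum_congr rfl fun i _ => ?_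
      rw [Finset.sum_comm]
    · intro
      constructor <;> intro <;> refine PHaux.lin_D P (fun _ _ => ?_) b <;> constructor <;> intros <;>
        simp [TensorProduct.tmul_add, TensorProduct.add_tmul, tl, tq,
          act_add_left, act_smul, mul_add, P.tr_add_left, P.tr_smul_left, tw]
    · intro
      constructor <;> intro <;> refine PHaux.lin_D P (fun _ _ => ?_) b <;> constructor <;> intros <;>
        simp [TensorProduct.tmul_add, TensorProduct.add_tmul, tl, tq,
          act_add_left, act_smul, mul_add, P.tr_add_left, P.tr_smul_left, tw]
  · intro x
    induction x using TensorProduct.induction_on with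
    | zero => simp [z1]
    | add x y hx hy => rw [trH_add_left, hx, hy, map_add, TensorProduct.add_tmul]
    | tmul f a => rw [h1, hεH, one1, TensorProduct.tmul_smul, tw]
  · intro x
    induction x using TensorProduct.induction_on with
    | zero => simp [z2]
    | add x y hx hy => rw [trH_add_right, hx, hy]
    | tmul g b =>
      rw [htr', PHaux.D_one P (k := k), act_one, one_mul, PHaux.one_tr]
      constructor <;> intro <;> constructor <;> intros <;>
        simp [TensorProduct.tmul_add, TensorProduct.add_tmul, act_add_left, act_smul,
          P.tr_add_left, P.tr_smul_left, tw]
  · intro x y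
    induction x using TensorProduct.induction_on with
    | zero => simp [z1]
    | add x x' hx hy => rw [trH_add_left, map_add, TensorProduct.add_tmul, hx, hy, trH_add_left]
    | tmul f a =>
      induction y using TensorProduct.induction_on with
      | zero => simp [z2]
      | add x x' hx hy =>
        rw [trH_add_right, map_add, TensorProduct.add_tmul, hx, hy, map_add,
          TensorProduct.add_tmul, trH_add_right]
      | tmul g b =>
        rw [hεH, h2, htr', act_gl1]
        congr 1
        refine (map_sum εH _ _).trans (Eq.trans (PHaux.D_congr P (B' := fun x y =>
          Coalgebra.counit (R := k) y • (f * (Coalgebra.counit (R := k) b • act x g)))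
          (B := fun x y => εH ((f * act x g) ⊗ₜ[k] P.tr y b)) ?_ a)
          (PHaux.D_counit_r P (k := k)
            (G := fun x => f * (Coalgebra.counit (R := k) b • act x g)) ?_ a))
        · intro x y
          rw [hεH, P.counit_tr, mul_smul, mul_smul_comm]
        · constructor <;> intros <;> simp [act_add_left, act_smul, mul_add, smul_comm (Coalgebra.counit (R := k) b)]
  · intro f x y
    induction x using TensorProduct.induction_on with
    | zero => simp [z1]
    | add x x' hx hy => rw [smul_add, trH_add_left, hx, hy, trH_add_left, smul_add]
    | tmul f' a =>
      induction y using TensorProduct.induction_on with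
      | zero => simp [z2]
      | add x x' hx hy => rw [trH_add_right, hx, hy, trH_add_right, smul_add]
      | tmul g b =>
        rw [TensorProduct.smul_tmul', htr, htr, Finset.smul_sum]
        simp [TensorProduct.smul_tmul', mul_assoc]
  · intro f a y z
    induction y using TensorProduct.induction_on with
    | zero => simp [z2]
    | add x x' hx hy => simp only [add_mul, trH_add_right, hx, hy, Finset.sum_add_distrib]
    | tmul g b =>
      induction z using TensorProduct.induction_on with
      | zero => simp [z2]
      | add x x' hx hy => simp only [mul_add, trH_add_right, hx, hy, Finset.sum_add_distrib]
      | tmul g' b' =>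
        rw [Algebra.TensorProduct.tmul_mul_tmul, htr']
        have e := PHaux.D_swap P hcc (F := fun x y z w =>
          (f * (act x g * act y g')) ⊗ₜ[k] (P.tr z b * P.tr w b')) (by
            constructor <;> intro _ _ _ <;> constructor <;> intros <;>
            simp [act_add_left, act_smul, mul_add, add_mul, TensorProduct.add_tmul,
              TensorProduct.tmul_add, P.tr_add_left, P.tr_smul_left, tw]) a
        refine Eq.trans (PHaux.D_congr P (fun u v => ?_) a) (e.trans ?_)
        · rw [act_m, P.tr_mul]
          simp only [PHaux.D, Finset.mul_sum, TensorProduct.sum_tmul, TensorProduct.tmul_sum]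
          rw [Finset.sum_comm]
        · refine PHaux.D_congr P (B' := fun u v => trH (f ⊗ₜ[k] u) (g ⊗ₜ[k] b) *
            trH ((1 : R) ⊗ₜ[k] v) (g' ⊗ₜ[k] b')) (fun u v => ?_) a
          simp only [htr, PHaux.D, Finset.sum_mul_sum, Algebra.TensorProduct.tmul_mul_tmul,
            one_mul, mul_assoc]
  · intro f a y z
    induction y using TensorProduct.induction_on with
    | zero => simp [z2, z1]
    | add x x' hx hy =>
      simp only [trH_add_left, trH_add_right, hx, hy, mul_add, Finset.sum_add_distrib]
    | tmul g b =>
      induction z using TensorProduct.induction_on with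
      | zero => simp [z2]
      | add x x' hx hy => simp only [trH_add_right, hx, hy]
      | tmul h c =>
        have R1 : (∑ i ∈ Finset.range (P.n a),
              (f ⊗ₜ[k] P.c1 a i) * trH ((1 : R) ⊗ₜ[k] P.c2 a i) (g ⊗ₜ[k] b)) =
            PHaux.D P (fun x y => (f * act x g) ⊗ₜ[k] P.gl y b) a := by
          have t1 : ∀ w : A, PHaux.Bil k (fun x y => (f * act y g) ⊗ₜ[k] (x * P.tr w b)) := by
            intro w
            constructor <;> intro <;> constructor <;> intros <;>
              simp [act_add_left, act_smul, mul_add, add_mul, TensorProduct.add_tmul,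
                TensorProduct.tmul_add, tw]
          have t2 : ∀ x : A, PHaux.Bil k (fun y w => (f * act y g) ⊗ₜ[k] (x * P.tr w b)) := by
            intro w
            constructor <;> intro <;> constructor <;> intros <;>
              simp [act_add_left, act_smul, mul_add, add_mul, TensorProduct.add_tmul,
                TensorProduct.tmul_add, tw, P.tr_add_left, P.tr_smul_left]
          have t3 : ∀ y : A, PHaux.Bil k (fun x w => (f * act y g) ⊗ₜ[k] (x * P.tr w b)) :=
            fun y => ⟨fun w => (t1 w).l y, fun x => (t2 x).r y⟩
          have c1 := PHaux.D_coassoc P (F := fun x y w => (f * act y g) ⊗ₜ[k] (x * P.tr w b))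
            t1 t2 a
          have c2 := PHaux.D_coassoc P (F := fun y x w => (f * act y g) ⊗ₜ[k] (x * P.tr w b))
            (fun w => ⟨fun x => (t1 w).r x, fun y => (t1 w).l y⟩) t3 a
          have c3 : ∀ u w, PHaux.D P (fun x y => (f * act y g) ⊗ₜ[k] (x * P.tr w b)) u =
            PHaux.D P (fun y x => (f * act y g) ⊗ₜ[k] (x * P.tr w b)) u := fun u w =>
            (PHaux.D_cc P hcc (t1 w) u).symm
          rw [PHaux.D_congr P c3, c2] at c1
          refine Eq.trans ?_ (c1.symm.trans ?_)
          · refine PHaux.D_congr P (B := fun x v => (f ⊗ₜ[k] x) * trH ((1 : R) ⊗ₜ[k] v) (g ⊗ₜ[k] b))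
              (fun x v => ?_) a
            simp only [htr, PHaux.D, Finset.mul_sum, Algebra.TensorProduct.tmul_mul_tmul, one_mul]
          · refine PHaux.D_congr P (fun x v => ?_) a
            rw [PHaux.gl_eq]
            simp only [PHaux.D, TensorProduct.tmul_sum]
        rw [R1]
        have R2 : trH (PHaux.D P (fun x y => (f * act x g) ⊗ₜ[k] P.gl y b) a) (h ⊗ₜ[k] c) =
            PHaux.D P (fun x v => PHaux.D P (fun y w => PHaux.D P (fun b1 b2 =>
              (f * act x g * act (P.gl y b1) h) ⊗ₜ[k] P.tr (P.gl w b2) c) b) v) a := by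
          refine (hs1 _ _ _).trans (PHaux.D_congr P
            (B := fun x y => trH ((f * act x g) ⊗ₜ[k] P.gl y b) (h ⊗ₜ[k] c)) (fun x v => ?_) a)
          rw [htr', PHaux.D_gl P hcc]
          constructor <;> intro <;> constructor <;> intros <;>
            simp [act_add_left, act_smul, mul_add, TensorProduct.add_tmul,
                TensorProduct.tmul_add, tw, P.tr_add_left, P.tr_smul_left]
        have gal : ∀ x y b, P.gl (x + y) b = P.gl x b + P.gl y b :=
          fun x y b => (PHaux.gl_l P b).map_add x y
        have gsl : ∀ (s : k) x b, P.gl (s • x) b = s • P.gl x b :=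
          fun s x b => (PHaux.gl_l P b).map_smul s x
        rw [R2, ← PHaux.D_coassoc P (k := k) (F := fun x y w => PHaux.D P (fun b1 b2 =>
              (f * act x g * act (P.gl y b1) h) ⊗ₜ[k] P.tr (P.gl w b2) c) b)]
        · rw [htr, hs2]
          simp only [htr]
          rw [Finset.sum_comm]
          refine Finset.sum_congr rfl fun i _ => ?_
          simp only [PHaux.D]
          rw [Finset.sum_comm]
          refine Finset.sum_congr rfl fun j _ => ?_
          rw [act_mul_right, Finset.mul_sum, TensorProduct.sum_tmul, P.tr_tr]
          simp only [act_glmul, mul_assoc]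
          rfl
        · intro
          constructor <;> intro <;> refine PHaux.lin_D P (fun _ _ => ?_) b <;> constructor <;>
            intros <;> simp [TensorProduct.tmul_add, TensorProduct.add_tmul, gal, gsl, add_mul,
              act_add_left, act_smul, mul_add, P.tr_add_left, P.tr_smul_left, tw]
        · intro
          constructor <;> intro <;> refine PHaux.lin_D P (fun _ _ => ?_) b <;> constructor <;>
            intros <;> simp [TensorProduct.tmul_add, TensorProduct.add_tmul, gal, gsl, add_mul,
              act_add_left, act_smul, mul_add, P.tr_add_left, P.tr_smul_left, tw]
end
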